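/- Let k be a field of characteristic p (p prime), c ∈ ℕ, and n ∈ ℕ with cp ≤ n ≤ (c+1)p − 1, n ≥ 1, and suppose 1 ≤ a ≤ n − cp. Then the rank-one twisted p-complex (Sym_n, D_a), where D_a(f) = ∂(f) + a·e_1·f (coefficient a cast from ℕ into k), is acyclic: for every s with 1 ≤ s ≤ p−1, {f ∈ Sym_n : D_a^s f = 0} = D_a^{p−s}(Sym_n). (This is the acyclicity of the rank-one p-DG module S_n(a) over Sym_n for 1 ≤ a ≤ n − cp.) -/

import Mathlib

open MvPolynomial

theorem cast_choose_sub_one_mul_neg_one_pow {A : Type*} [Ring A] (p : ℕ) [hp : Fact p.Prime]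
    [CharP A p] (i : ℕ) (hi : i < p) :
    (-1 : A) ^ i * ((p - 1).choose i : A) = 1 := by
  induction i with
  | zero => simp
  | succ i ih =>
    have h : ((p.choose (i + 1) : ℕ) : A) = 0 :=
      (CharP.cast_eq_zero_iff A p _).2 (hp.out.dvd_choose_self (by omega) hi)
    obtain ⟨q, rfl⟩ : ∃ q, p = q + 1 := ⟨p - 1, by have := hp.out.pos; omega⟩
    rw [Nat.choose_succ_succ, Nat.cast_add] at h
    rw [Nat.add_sub_cancel] at ih ⊢
    rw [eq_neg_of_add_eq_zero_right h, pow_succ, mul_neg_one, neg_mul_neg]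
    exact ih (by omega)

theorem sum_pow_mul_mul_pow_eq_iterate_commutator {A : Type*} [Ring A] (p : ℕ)
    [hp : Fact p.Prime] [CharP A p] (x h : A) :
    ∑ i ∈ Finset.range p, x ^ (p - 1 - i) * h * x ^ i = (fun y => x * y - y * x)^[p - 1] h := by
  have hit : (fun y => x * y - y * x) = ⇑(-LinearMap.mulRight ℤ x + LinearMap.mulLeft ℤ x) := by
    ext y; simp [sub_eq_neg_add]
  have hcomm : Commute (-LinearMap.mulRight ℤ x) (LinearMap.mulLeft ℤ x) :=
    ((LinearMap.commute_mulLeft_right (R := ℤ) x x).symm).neg_left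
  rw [hit, ← Module.End.pow_apply, hcomm.add_pow, Nat.sub_add_cancel hp.out.pos,
    LinearMap.sum_apply]
  refine Finset.sum_congr rfl fun i hi => ?_
  have hc := cast_choose_sub_one_mul_neg_one_pow (A := A) p i (Finset.mem_range.1 hi)
  have hneg : (-1 : Module.End ℤ A) ^ i = (((-1) ^ i : ℤ) : Module.End ℤ A) := by push_cast; rfl
  rw [neg_pow, LinearMap.pow_mulRight, LinearMap.pow_mulLeft, hneg]
  simp only [Module.End.mul_apply, Module.End.natCast_apply, Module.End.intCast_apply,
    LinearMap.mulLeft_apply, LinearMap.mulRight_apply, nsmul_eq_mul, zsmul_eq_mul]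
  push_cast
  have hx := (Nat.cast_commute ((p - 1).choose i) (x ^ (p - 1 - i))).eq
  calc x ^ (p - 1 - i) * h * x ^ i
      = ((-1) ^ i * ((p - 1).choose i : A)) * (x ^ (p - 1 - i) * h * x ^ i) := by
        rw [hc, one_mul]
    _ = _ := by
        simp only [mul_assoc]
        rw [← mul_assoc _ (x ^ (p - 1 - i)), hx, mul_assoc]

theorem iterate_commutator_pow {A : Type*} [Ring A] (x y z : A) (hxy : x * y - y * x = z)
    (hxz : Commute x z) (hyz : Commute y z) (t : ℕ) :
    (fun w => x * w - w * x)^[t] (y ^ t) = (t.factorial : A) * z ^ t := by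
  have hpow (j : ℕ) : x * y ^ (j + 1) - y ^ (j + 1) * x = ((j + 1 : ℕ) : A) * (y ^ j * z) := by
    induction j with
    | zero => simpa using hxy
    | succ j ih =>
      have h : x * y ^ (j + 2) - y ^ (j + 2) * x
          = (x * y ^ (j + 1) - y ^ (j + 1) * x) * y + y ^ (j + 1) * (x * y - y * x) := by
        rw [pow_succ y (j + 1)]; noncomm_ring
      rw [h, ih, hxy, mul_assoc, mul_assoc, ← hyz.eq, ← mul_assoc (y ^ j), ← pow_succ]
      push_cast
      noncomm_ring
  have hiter (m : ℕ) (c : ℕ) (w : A) : (fun w => x * w - w * x)^[m] ((c : A) * (w * z))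
      = (c : A) * ((fun w => x * w - w * x)^[m] w * z) := by
    induction m generalizing w with
    | zero => rfl
    | succ m ih =>
      rw [Function.iterate_succ_apply, Function.iterate_succ_apply, ← ih]
      congr 1
      have := (Nat.cast_commute c x).eq
      simp only [mul_sub, sub_mul, mul_assoc, ← hxz.eq]
      rw [← mul_assoc x, ← this, mul_assoc]
  induction t with
  | zero => simp
  | succ t ih =>
    rw [Function.iterate_succ_apply, hpow, hiter, ih, Nat.factorial_succ]
    push_cast
    rw [pow_succ]
    simp only [mul_assoc]

/-- The `i`-th summand of the twisted differential: it sends `x^u` to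
`(u i + 1 - l) • x^(u + δ_i)`. -/
noncomputable def raise {n : ℕ} (k : Type*) [Field k] (l : ℕ) (i : Fin n) :
    MvPolynomial (Fin n) k →ₗ[k] MvPolynomial (Fin n) k :=
  (basisMonomials (Fin n) k).constr k fun u =>
    ((u i : k) + 1 - l) • monomial (u + Finsupp.single i 1) 1

/-- The contracting partner of `raise`: it sends `x^u` to `-x^(u - δ_i)` when `l ≤ u i` and
`p ∤ u i - l`, and to `0` otherwise. -/
noncomputable def lower {n : ℕ} (k : Type*) [Field k] (p l : ℕ) (i : Fin n) :
    MvPolynomial (Fin n) k →ₗ[k] MvPolynomial (Fin n) k :=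
  (basisMonomials (Fin n) k).constr k fun u =>
    if l ≤ u i ∧ ¬ p ∣ u i - l then -monomial (u - Finsupp.single i 1) 1 else 0

/-- The projection onto the span of the monomials whose `i`-th exponent is at least `l`. -/
noncomputable def cutoff {n : ℕ} (k : Type*) [Field k] (l : ℕ) (i : Fin n) :
    MvPolynomial (Fin n) k →ₗ[k] MvPolynomial (Fin n) k :=
  (basisMonomials (Fin n) k).constr k fun u => if l ≤ u i then monomial u 1 else 0

section
variable {n : ℕ} {k : Type*} [Field k]

theorem raise_monomial (l : ℕ) (i : Fin n) (u : Fin n →₀ ℕ) :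
    raise k l i (monomial u 1) = ((u i : k) + 1 - l) • monomial (u + Finsupp.single i 1) 1 := by
  rw [← congr_fun (coe_basisMonomials (Fin n) k) u, raise, Module.Basis.constr_basis]

theorem lower_monomial (p l : ℕ) (i : Fin n) (u : Fin n →₀ ℕ) :
    lower k p l i (monomial u 1) =
      if l ≤ u i ∧ ¬ p ∣ u i - l then -monomial (u - Finsupp.single i 1) 1 else 0 := by
  rw [← congr_fun (coe_basisMonomials (Fin n) k) u, lower, Module.Basis.constr_basis]

theorem cutoff_monomial (l : ℕ) (i : Fin n) (u : Fin n →₀ ℕ) :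
    cutoff k l i (monomial u 1) = if l ≤ u i then monomial u 1 else 0 := by
  simpa [cutoff] using (basisMonomials (Fin n) k).constr_basis k
    (fun u => if l ≤ u i then monomial u (1 : k) else 0) u

theorem linearMap_ext_monomial {f g : MvPolynomial (Fin n) k →ₗ[k] MvPolynomial (Fin n) k}
    (h : ∀ u, f (monomial u 1) = g (monomial u 1)) : f = g :=
  (basisMonomials (Fin n) k).ext fun u => by simpa using h u

theorem commute_raise_raise (l : ℕ) (i j : Fin n) : Commute (raise k l i) (raise k l j) := by
  rcases eq_or_ne i j with rfl | hij
  · exact Commute.refl _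
  refine linearMap_ext_monomial fun u => ?_
  simp only [Module.End.mul_apply, raise_monomial, map_smul, smul_smul, Finsupp.add_apply,
    Finsupp.single_eq_of_ne hij, Finsupp.single_eq_of_ne hij.symm, add_zero]
  rw [mul_comm, add_right_comm]

theorem commute_raise_cutoff (l : ℕ) (i j : Fin n) : Commute (raise k l i) (cutoff k l j) := by
  refine linearMap_ext_monomial fun u => ?_
  rcases eq_or_ne i j with rfl | hij
  · simp only [Module.End.mul_apply, raise_monomial, cutoff_monomial, map_smul,
      Finsupp.add_apply, Finsupp.single_eq_same]
    by_cases h : l ≤ u i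
    · rw [if_pos h, if_pos (by omega), raise_monomial]
    · by_cases h' : l ≤ u i + 1
      · have : l = u i + 1 := by omega
        simp [this]
      · simp [h, h']
  · simp only [Module.End.mul_apply, raise_monomial, cutoff_monomial, map_smul,
      Finsupp.add_apply, Finsupp.single_eq_of_ne hij.symm, add_zero]
    split_ifs <;> simp [raise_monomial]

theorem commute_lower_cutoff (p l : ℕ) (i j : Fin n) :
    Commute (lower k p l i) (cutoff k l j) := by
  refine linearMap_ext_monomial fun u => ?_
  simp only [Module.End.mul_apply, lower_monomial, cutoff_monomial]
  have key : (l ≤ u i ∧ ¬ p ∣ u i - l) →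
      (l ≤ u j ↔ l ≤ (u - Finsupp.single i 1 : Fin n →₀ ℕ) j) := by
    rintro ⟨h1, h2⟩
    rcases eq_or_ne i j with rfl | hij
    · have : u i - l ≠ 0 := fun h => h2 (h ▸ dvd_zero p)
      simp; omega
    · simp [Finsupp.single_eq_of_ne hij.symm]
  by_cases hi : l ≤ u i ∧ ¬ p ∣ u i - l
  · by_cases hj : l ≤ u j
    · simp only [if_pos hi, if_pos hj, lower_monomial, map_neg, cutoff_monomial,
        if_pos ((key hi).1 hj)]
    · simp only [if_pos hi, if_neg hj, map_neg, cutoff_monomial,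
        if_neg (mt (key hi).2 hj), map_zero, neg_zero]
  · rw [if_neg hi, map_zero]
    split_ifs
    · rw [lower_monomial, if_neg hi]
    · simp

theorem commute_raise_lower (p l : ℕ) {i j : Fin n} (hij : i ≠ j) :
    Commute (raise k l i) (lower k p l j) := by
  refine linearMap_ext_monomial fun u => ?_
  simp only [Module.End.mul_apply, raise_monomial, lower_monomial, map_smul,
      Finsupp.add_apply, Finsupp.single_eq_of_ne hij.symm, add_zero]
  split_ifs with h
  · have h0 : u j ≠ 0 := by
      rintro h0
      exact h.2 (by simp [h0])
    have : u + Finsupp.single i 1 - Finsupp.single j 1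
        = u - Finsupp.single j 1 + Finsupp.single i 1 := by
      ext t
      rcases eq_or_ne t j with rfl | ht
      · simp [Finsupp.single_eq_of_ne hij.symm]
      · simp [Finsupp.single_eq_of_ne ht]
    rw [this, map_neg, raise_monomial]
    simp [Finsupp.single_eq_of_ne hij]
  · simp

theorem raise_mul_lower_sub (p l : ℕ) [CharP k p] (i : Fin n) :
    raise k l i * lower k p l i - lower k p l i * raise k l i = cutoff k l i := by
  refine linearMap_ext_monomial fun u => ?_
  simp only [LinearMap.sub_apply, Module.End.mul_apply, raise_monomial, lower_monomial, map_smul,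
      Finsupp.add_apply, Finsupp.single_eq_same, cutoff_monomial, add_tsub_cancel_right]
  by_cases h : l ≤ u i
  · obtain ⟨b, hb⟩ := Nat.exists_eq_add_of_le h
    have e1 : u i - l = b := by omega
    have e2 : u i + 1 - l = b + 1 := by omega
    have e3 : l ≤ u i + 1 := by omega
    have e4 : (u i : k) = l + b := by rw [hb]; push_cast; rfl
    have hcast := CharP.cast_eq_zero_iff k p
    simp only [h, e1, e2, e3, true_and, if_true]
    have lhs : raise k l i (if ¬ p ∣ b then -monomial (u - Finsupp.single i 1) 1 else 0)
        = (-(b : k)) • monomial u 1 := by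
      by_cases hb' : p ∣ b
      · rw [(hcast b).2 hb']; simp [hb']
      · rw [if_pos hb']
        have hb0 : b ≠ 0 := by rintro rfl; exact hb' (dvd_zero p)
        have hu : u - Finsupp.single i 1 + Finsupp.single i 1 = u := by
          ext t
          rcases eq_or_ne t i with rfl | ht
          · simp; omega
          · simp [Finsupp.single_eq_of_ne ht]
        rw [map_neg, raise_monomial, hu, neg_smul]
        congr 2
        rw [Finsupp.tsub_apply, Finsupp.single_eq_same, Nat.cast_sub (by omega), e4]
        push_cast; ring
    rw [lhs, e4]
    by_cases hb' : p ∣ b + 1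
    · have : (b : k) + 1 = 0 := by exact_mod_cast (hcast (b + 1)).2 hb'
      rw [eq_neg_of_add_eq_zero_left this]
      simp [hb']
    · rw [if_pos hb', smul_neg, sub_neg_eq_add, ← add_smul]
      convert one_smul k _ using 2
      ring
  · by_cases h' : l ≤ u i + 1
    · have : u i + 1 - l = 0 := by omega
      simp [h, this]
    · simp [h, h']

theorem raise_pow_monomial (l t : ℕ) (i : Fin n) (u : Fin n →₀ ℕ) :
    (raise k l i ^ t) (monomial u 1) =
      (∏ m ∈ Finset.range t, ((u i + m : ℕ) + 1 - l : k)) • monomial (u + Finsupp.single i t) 1 := by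
  induction t with
  | zero => simp
  | succ t ih =>
    rw [pow_succ', Module.End.mul_apply, ih, map_smul, raise_monomial, smul_smul,
      Finset.prod_range_succ, add_assoc, ← Finsupp.single_add]
    simp

theorem raise_pow_char (p l : ℕ) (hp : p.Prime) [CharP k p] (i : Fin n) :
    raise k l i ^ p = 0 := by
  refine linearMap_ext_monomial fun u => ?_
  rw [raise_pow_monomial, Finset.prod_eq_zero (i := ((l : ℤ) - u i - 1).natMod p), zero_smul]
  · rfl
  · exact Finset.mem_range.2 (Int.natMod_lt hp.ne_zero)
  · have h1 : (((l : ℤ) - u i - 1).natMod p : ℤ) = ((l : ℤ) - u i - 1) % p := by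
      rw [Int.natMod, Int.toNat_of_nonneg (Int.emod_nonneg _ (by exact_mod_cast hp.ne_zero))]
    have h2 : ((((l : ℤ) - u i - 1).natMod p : ℤ) : k) = (((l : ℤ) - u i - 1 : ℤ) : k) := by
      rw [h1, CharP.intCast_eq_intCast k p]
      exact Int.mod_modEq _ _
    push_cast at h2 ⊢
    rw [h2]; ring

theorem rename_raise (l : ℕ) (σ : Equiv.Perm (Fin n)) (i : Fin n) (f : MvPolynomial (Fin n) k) :
    rename σ (raise k l i f) = raise k l (σ i) (rename σ f) := by
  suffices h : (rename σ).toLinearMap ∘ₗ raise k l i = raise k l (σ i) ∘ₗ (rename σ).toLinearMap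
    from LinearMap.congr_fun h f
  refine linearMap_ext_monomial fun u => ?_
  simp only [LinearMap.comp_apply, AlgHom.toLinearMap_apply, raise_monomial, rename_monomial,
    map_smul, Finsupp.mapDomain_add, Finsupp.mapDomain_single,
    Finsupp.mapDomain_apply σ.injective]

theorem rename_lower (p l : ℕ) (σ : Equiv.Perm (Fin n)) (i : Fin n)
    (f : MvPolynomial (Fin n) k) :
    rename σ (lower k p l i f) = lower k p l (σ i) (rename σ f) := by
  suffices h : (rename σ).toLinearMap ∘ₗ lower k p l i
      = lower k p l (σ i) ∘ₗ (rename σ).toLinearMap from LinearMap.congr_fun h f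
  refine linearMap_ext_monomial fun u => ?_
  simp only [LinearMap.comp_apply, AlgHom.toLinearMap_apply, lower_monomial, rename_monomial,
    Finsupp.mapDomain_apply σ.injective]
  split_ifs
  · have : (u - Finsupp.single i 1).mapDomain σ = u.mapDomain σ - Finsupp.single (σ i) 1 := by
      ext t
      obtain ⟨t, rfl⟩ := σ.surjective t
      simp only [Finsupp.tsub_apply, Finsupp.mapDomain_apply σ.injective, Finsupp.single_apply,
        σ.injective.eq_iff]
    rw [map_neg, rename_monomial, this]
  · simp

theorem rename_sum_raise (l : ℕ) (σ : Equiv.Perm (Fin n)) (f : MvPolynomial (Fin n) k) :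
    rename σ ((∑ i, raise k l i) f) = (∑ i, raise k l i) (rename σ f) := by
  simp only [LinearMap.sum_apply, map_sum, rename_raise]
  exact Equiv.sum_comp σ fun i => raise k l i (rename σ f)

theorem rename_sum_lower (p l : ℕ) (σ : Equiv.Perm (Fin n)) (f : MvPolynomial (Fin n) k) :
    rename σ ((∑ i, lower k p l i) f) = (∑ i, lower k p l i) (rename σ f) := by
  simp only [LinearMap.sum_apply, map_sum, rename_lower]
  exact Equiv.sum_comp σ fun i => lower k p l i (rename σ f)

theorem sum_raise_pow_char (p l : ℕ) [hp : Fact p.Prime] [CharP k p]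
    [CharP (Module.End k (MvPolynomial (Fin n) k)) p] :
    (∑ i, raise k l i : Module.End k (MvPolynomial (Fin n) k)) ^ p = 0 := by
  suffices h : ∀ s : Finset (Fin n),
      (∑ i ∈ s, raise k l i : Module.End k (MvPolynomial (Fin n) k)) ^ p = 0 from h _
  intro s
  induction s using Finset.induction_on with
  | empty => simp [hp.out.ne_zero]
  | insert i s hi ih =>
    rw [Finset.sum_insert hi, add_pow_expChar_of_commute (p := p), ih,
      raise_pow_char p l hp.out, add_zero]
    exact Commute.sum_right _ _ _ fun j _ => commute_raise_raise l i j

theorem sum_raise_lower_commutator (p l : ℕ) [CharP k p] :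
    (∑ i : Fin n, raise k l i) * (∑ i, lower k p l i) - (∑ i, lower k p l i) * (∑ i, raise k l i)
      = ∑ i, cutoff k l i := by
  rw [Finset.sum_mul_sum, Finset.sum_mul_sum, Finset.sum_comm (s := Finset.univ) (t := Finset.univ)
    (f := fun i j => lower k p l i * raise k l j), ← Finset.sum_sub_distrib]
  refine Finset.sum_congr rfl fun i _ => ?_
  rw [← Finset.sum_sub_distrib, Finset.sum_eq_single i, raise_mul_lower_sub p l]
  · intro j _ hj
    rw [(commute_raise_lower p l hj.symm).eq, sub_self]
  · simp

theorem coeff_cutoff (l : ℕ) (i : Fin n) (u : Fin n →₀ ℕ) (f : MvPolynomial (Fin n) k) :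
    coeff u (cutoff k l i f) = if l ≤ u i then coeff u f else 0 := by
  suffices h : (lcoeff k u) ∘ₗ cutoff k l i = (if l ≤ u i then lcoeff k u else 0) by
    have := LinearMap.congr_fun h f
    split_ifs at this ⊢ <;> exact this
  refine (basisMonomials (Fin n) k).ext fun v => ?_
  rw [coe_basisMonomials, LinearMap.comp_apply, cutoff_monomial]
  rcases eq_or_ne v u with rfl | h
  · split_ifs <;> simp
  · split_ifs <;> simp [coeff_monomial, h]

theorem coeff_sum_cutoff_pow (l t : ℕ) (u : Fin n →₀ ℕ) (f : MvPolynomial (Fin n) k) :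
    coeff u (((∑ i, cutoff k l i : Module.End k (MvPolynomial (Fin n) k)) ^ t) f)
      = ((Finset.univ.filter fun i => l ≤ u i).card : k) ^ t * coeff u f := by
  induction t with
  | zero => simp
  | succ t ih =>
    rw [pow_succ', Module.End.mul_apply, LinearMap.sum_apply, coeff_sum]
    simp only [coeff_cutoff, ih]
    rw [← Finset.sum_filter, Finset.sum_const, nsmul_eq_mul, pow_succ', mul_assoc]

/-- A polynomial is alternating if for each transposition `τ` it has the form `h - τ h`. In every
characteristic this says that it changes sign under transpositions and has no monomial with a
repeated exponent. -/
def IsAlternating (g : MvPolynomial (Fin n) k) : Prop :=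
  ∀ i j, i ≠ j → ∃ h, g = h - rename (Equiv.swap i j) h

theorem IsAlternating.map {g : MvPolynomial (Fin n) k} (hg : IsAlternating g)
    (T : MvPolynomial (Fin n) k →ₗ[k] MvPolynomial (Fin n) k)
    (hT : ∀ (σ : Equiv.Perm (Fin n)) f, rename σ (T f) = T (rename σ f)) :
    IsAlternating (T g) := by
  intro i j hij
  obtain ⟨h, rfl⟩ := hg i j hij
  exact ⟨T h, by rw [map_sub, hT]⟩

theorem IsAlternating.pow {g : MvPolynomial (Fin n) k} (hg : IsAlternating g)
    (T : Module.End k (MvPolynomial (Fin n) k))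
    (hT : ∀ (σ : Equiv.Perm (Fin n)) f, rename σ (T f) = T (rename σ f)) (t : ℕ) :
    IsAlternating ((T ^ t) g) := by
  induction t with
  | zero => exact hg
  | succ t ih => rw [pow_succ', Module.End.mul_apply]; exact ih.map T hT

theorem IsAlternating.sum {ι : Type*} (s : Finset ι) (g : ι → MvPolynomial (Fin n) k)
    (hg : ∀ t, IsAlternating (g t)) : IsAlternating (∑ t ∈ s, g t) := by
  intro i j hij
  choose h hh using fun t => hg t i j hij
  refine ⟨∑ t ∈ s, h t, ?_⟩
  rw [map_sum, ← Finset.sum_sub_distrib]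
  exact Finset.sum_congr rfl fun t _ => hh t

theorem IsAlternating.neg {g : MvPolynomial (Fin n) k} (hg : IsAlternating g) :
    IsAlternating (-g) := by
  intro i j hij
  obtain ⟨h, rfl⟩ := hg i j hij
  exact ⟨-h, by rw [map_neg]; ring⟩

theorem rename_swap_rename_swap (i j : Fin n) (f : MvPolynomial (Fin n) k) :
    rename (Equiv.swap i j) (rename (Equiv.swap i j) f) = f := by
  rw [rename_rename, ← Equiv.coe_trans, Equiv.swap_swap, Equiv.coe_refl, rename_id_apply]

theorem IsAlternating.rename_swap {g : MvPolynomial (Fin n) k} (hg : IsAlternating g)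
    {i j : Fin n} (hij : i ≠ j) : rename (Equiv.swap i j) g = -g := by
  obtain ⟨h, rfl⟩ := hg i j hij
  rw [map_sub, rename_swap_rename_swap]; ring

theorem IsAlternating.coeff_eq_zero {g : MvPolynomial (Fin n) k} (hg : IsAlternating g)
    {u : Fin n →₀ ℕ} (hu : ¬ Function.Injective u) : coeff u g = 0 := by
  simp only [Function.Injective, not_forall] at hu
  obtain ⟨i, j, hij, hne⟩ := hu
  obtain ⟨h, rfl⟩ := hg i j hne
  have hfix : u.mapDomain (Equiv.swap i j) = u := by
    ext t
    obtain ⟨t, rfl⟩ := (Equiv.swap i j).surjective t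
    rw [Finsupp.mapDomain_apply (Equiv.injective _)]
    rw [Equiv.swap_apply_def]
    split_ifs with h1 h2
    · rw [h1, hij]
    · rw [h2, hij]
    · rfl
  rw [coeff_sub]
  conv_lhs => rw [← hfix]
  rw [coeff_rename_mapDomain _ (Equiv.injective _), hfix, sub_self]

theorem IsAlternating.X_sub_X_dvd {g : MvPolynomial (Fin n) k} (hg : IsAlternating g)
    {i j : Fin n} (hij : i ≠ j) : (X j - X i : MvPolynomial (Fin n) k) ∣ g := by
  obtain ⟨h, rfl⟩ := hg i j hij
  set I : Ideal (MvPolynomial (Fin n) k) := Ideal.span {X j - X i}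
  have hX : Ideal.Quotient.mkₐ k I (X j) = Ideal.Quotient.mkₐ k I (X i) :=
    Ideal.Quotient.eq.2 (Ideal.subset_span rfl)
  have hhom : (Ideal.Quotient.mkₐ k I).comp (rename (Equiv.swap i j)) = Ideal.Quotient.mkₐ k I := by
    refine algHom_ext fun t => ?_
    rw [AlgHom.comp_apply, rename_X, Equiv.swap_apply_def]
    split_ifs with h1 h2
    · rw [h1, hX]
    · rw [h2, hX]
    · rfl
  have := AlgHom.congr_fun hhom h
  exact Ideal.mem_span_singleton.1 (Ideal.Quotient.eq.1 this.symm)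

theorem irreducible_X_sub_X {i j : Fin n} (hij : i ≠ j) :
    Irreducible (X j - X i : MvPolynomial (Fin n) k) := by
  have h : (X j - X i : MvPolynomial (Fin n) k)
      = sumSMulX (Finsupp.single j 1 - Finsupp.single i 1) := by
    simp [sumSMulX]
  have hj : (Finsupp.single j 1 - Finsupp.single i 1 : Fin n →₀ k) j = 1 := by
    simp [Finsupp.single_eq_of_ne hij.symm]
  rw [h]
  refine irreducible_sumSMulX _ ⟨j, ?_⟩ fun r hr => ?_
  · rw [Finsupp.mem_support_iff, hj]; exact one_ne_zero
  · exact isUnit_of_dvd_one (hj ▸ hr j)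

theorem not_X_sub_X_dvd {i j a b : Fin n} (hab : a ≠ b) (h : (a ≠ i ∧ a ≠ j) ∨ (b ≠ i ∧ b ≠ j)) :
    ¬ (X j - X i : MvPolynomial (Fin n) k) ∣ X b - X a := by
  rintro ⟨q, hq⟩
  rcases h with ⟨h1, h2⟩ | ⟨h1, h2⟩
  · have := congrArg (eval (Pi.single a (1 : k))) hq
    simp [h1.symm, h2.symm, hab.symm] at this
  · have := congrArg (eval (Pi.single b (1 : k))) hq
    simp [h1.symm, h2.symm, hab] at this

/-- The Vandermonde determinant in the variables. -/
noncomputable def vdm (n : ℕ) (k : Type*) [Field k] : MvPolynomial (Fin n) k :=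
  (Matrix.vandermonde (X : Fin n → MvPolynomial (Fin n) k)).det

theorem vdm_eq_prod : vdm n k = ∏ i : Fin n, ∏ j ∈ Finset.Ioi i, (X j - X i) :=
  Matrix.det_vandermonde _

theorem vdm_ne_zero : vdm n k ≠ 0 :=
  Matrix.det_vandermonde_ne_zero_iff.2 (X_injective)

theorem rename_swap_vdm {i j : Fin n} (hij : i ≠ j) :
    rename (Equiv.swap i j) (vdm n k) = -vdm n k := by
  have h : (rename (Equiv.swap i j) : _ →ₐ[k] MvPolynomial (Fin n) k).mapMatrix
      (Matrix.vandermonde (X : Fin n → MvPolynomial (Fin n) k))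
      = (Matrix.vandermonde (X : Fin n → MvPolynomial (Fin n) k)).submatrix (Equiv.swap i j) id := by
    ext1 a b
    simp [Matrix.vandermonde_apply]
  rw [vdm, AlgHom.map_det, h, Matrix.det_permute, Equiv.Perm.sign_swap hij]
  simp

theorem X_sub_X_dvd_vdm {i j : Fin n} (hij : i < j) :
    (X j - X i : MvPolynomial (Fin n) k) ∣ vdm n k := by
  have h1 : (X j - X i : MvPolynomial (Fin n) k) ∣ ∏ t ∈ Finset.Ioi i, (X t - X i) :=
    Finset.dvd_prod_of_mem (fun t => (X t - X i : MvPolynomial (Fin n) k)) (Finset.mem_Ioi.2 hij)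
  rw [vdm_eq_prod]
  exact h1.trans (Finset.dvd_prod_of_mem
    (fun r : Fin n => ∏ t ∈ Finset.Ioi r, (X t - X r : MvPolynomial (Fin n) k)) (Finset.mem_univ i))

theorem isAlternating_vdm_mul {f : MvPolynomial (Fin n) k} (hf : f.IsSymmetric) :
    IsAlternating (vdm n k * f) := by
  intro i j hij
  have hdvd : (X j - X i : MvPolynomial (Fin n) k) ∣ vdm n k := by
    rcases lt_or_gt_of_ne hij with h | h
    · exact X_sub_X_dvd_vdm h
    · rw [← neg_sub, neg_dvd]
      exact X_sub_X_dvd_vdm h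
  obtain ⟨q, hq⟩ := hdvd
  have hne : (X j - X i : MvPolynomial (Fin n) k) ≠ 0 := (irreducible_X_sub_X hij).ne_zero
  have hqs : rename (Equiv.swap i j) q = q := by
    have h := rename_swap_vdm (k := k) hij
    rw [hq, map_mul, map_sub, rename_X, rename_X, Equiv.swap_apply_left,
      Equiv.swap_apply_right] at h
    refine mul_left_cancel₀ hne ?_
    linear_combination -h
  refine ⟨X j * q * f, ?_⟩
  rw [map_mul, map_mul, hqs, hf, rename_X, Equiv.swap_apply_right, hq]
  ring

theorem IsAlternating.exists_eq_vdm_mul {g : MvPolynomial (Fin n) k} (hg : IsAlternating g) :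
    ∃ f, f.IsSymmetric ∧ g = vdm n k * f := by
  have hdvd : vdm n k ∣ g := by
    rw [vdm_eq_prod, Finset.prod_sigma']
    refine Finset.prod_dvd_of_isRelPrime ?_ ?_
    · rintro ⟨i, j⟩ hij ⟨a, b⟩ hab hne
      simp only [Finset.coe_sigma, Set.mem_sigma_iff, Finset.coe_univ, Set.mem_univ, true_and,
        Finset.coe_Ioi, Set.mem_Ioi] at hij hab
      refine (irreducible_X_sub_X hij.ne).isRelPrime_iff_not_dvd.2 (not_X_sub_X_dvd hab.ne ?_)
      by_contra! hcon
      have : i = a ∧ j = b := by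
        obtain ⟨h1, h2⟩ := hcon
        by_cases hai : a = i
        · subst hai
          exact ⟨rfl, (h2 hab.ne').symm⟩
        · have haj := h1 hai
          subst haj
          by_cases hbi : b = i
          · subst hbi; exact absurd hij hab.not_gt
          · exact absurd (h2 hbi) hab.ne'
      exact hne (by rw [this.1, this.2])
    · rintro ⟨i, j⟩ hij
      simp only [Finset.mem_sigma, Finset.mem_univ, true_and, Finset.mem_Ioi] at hij
      exact hg.X_sub_X_dvd hij.ne
  obtain ⟨f, rfl⟩ := hdvd
  refine ⟨f, fun σ => ?_, rfl⟩
  induction σ using Equiv.Perm.swap_induction_on with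
  | one => exact rename_id_apply f
  | swap_mul σ i j hij ih =>
    rw [Equiv.Perm.coe_mul, ← rename_rename, ih]
    have h := hg.rename_swap hij
    rw [map_mul, rename_swap_vdm hij] at h
    refine mul_left_cancel₀ vdm_ne_zero ?_
    linear_combination -h

theorem Derivation.apply_prod_of_eigen {R A ι : Type*} [CommRing R] [CommRing A] [Algebra R A]
    (D : Derivation R A A) (s : Finset ι) (f c : ι → A) (h : ∀ i ∈ s, D (f i) = c i * f i) :
    D (∏ i ∈ s, f i) = (∑ i ∈ s, c i) * ∏ i ∈ s, f i := by
  classical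
  induction s using Finset.induction_on with
  | empty => simp
  | insert i s hi ih =>
    rw [Finset.prod_insert hi, Finset.sum_insert hi, D.leibniz, h i (Finset.mem_insert_self i s),
      ih fun j hj => h j (Finset.mem_insert_of_mem hj), smul_eq_mul, smul_eq_mul]
    ring

theorem derivation_vdm (D : Derivation k (MvPolynomial (Fin n) k) (MvPolynomial (Fin n) k))
    (hD : ∀ i, D (X i) = X i ^ 2) :
    D (vdm n k) = ((n : MvPolynomial (Fin n) k) - 1) * esymm (Fin n) k 1 * vdm n k := by
  have hsum : ∑ i : Fin n, ∑ j ∈ Finset.Ioi i, (X j + X i : MvPolynomial (Fin n) k)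
      = ((n : MvPolynomial (Fin n) k) - 1) * esymm (Fin n) k 1 := by
    rw [Finset.sum_sum_Ioi_add_eq_sum_sum_off_diag (fun j _ => (X j : MvPolynomial (Fin n) k))]
    have h (i : Fin n) : ∑ j ∈ {i}ᶜ, (X j : MvPolynomial (Fin n) k) = esymm (Fin n) k 1 - X i := by
      rw [esymm_one, ← Finset.sum_compl_add_sum {i}]
      simp
    simp only [h, Finset.sum_sub_distrib, ← esymm_one]
    simp
    ring
  rw [vdm_eq_prod, ← hsum]
  refine D.apply_prod_of_eigen _ _ _ fun i _ => D.apply_prod_of_eigen _ _ _ fun j _ => ?_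
  rw [map_sub, hD, hD]
  ring

theorem sum_raise_apply (l : ℕ)
    (D : Derivation k (MvPolynomial (Fin n) k) (MvPolynomial (Fin n) k))
    (hD : ∀ i, D (X i) = X i ^ 2) (f : MvPolynomial (Fin n) k) :
    (∑ i, raise k l i) f
      = D f + (1 - (l : MvPolynomial (Fin n) k)) * (esymm (Fin n) k 1 * f) := by
  have hD' : D = mkDerivation k fun i => X i ^ 2 :=
    derivation_ext fun i => by rw [hD, mkDerivation_X]
  suffices h : (∑ i, raise k l i) = (D : _ →ₗ[k] MvPolynomial (Fin n) k)
      + LinearMap.mulLeft k ((1 - (l : MvPolynomial (Fin n) k)) * esymm (Fin n) k 1) by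
    rw [h]
    simp [-esymm_one]
  refine linearMap_ext_monomial fun u => ?_
  rw [LinearMap.sum_apply, LinearMap.add_apply, Derivation.coeFn_coe,
    hD', mkDerivation_monomial, one_smul, Finsupp.sum_fintype _ _ (by simp),
    LinearMap.mulLeft_apply, esymm_one, Finset.mul_sum, Finset.sum_mul, ← Finset.sum_add_distrib]
  refine Finset.sum_congr rfl fun i _ => ?_
  have h1 : monomial (u - Finsupp.single i 1) (u i : k) • (X i ^ 2 : MvPolynomial (Fin n) k)
      = (u i : k) • monomial (u + Finsupp.single i 1) 1 := by
    rcases Nat.eq_zero_or_pos (u i) with h0 | h0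
    · simp [h0]
    · have hu : u - Finsupp.single i 1 + Finsupp.single i 2 = u + Finsupp.single i 1 := by
        ext t
        rcases eq_or_ne t i with rfl | ht
        · simp; omega
        · simp [Finsupp.single_eq_of_ne ht]
      rw [smul_eq_mul, X_pow_eq_monomial, monomial_mul, hu, smul_monomial]
      simp
  have h2 : (1 - (l : MvPolynomial (Fin n) k)) * X i * monomial u 1
      = (1 - l : k) • monomial (u + Finsupp.single i 1) 1 := by
    rw [mul_assoc, X, monomial_mul, add_comm, smul_eq_C_mul]
    simp
  rw [h1, h2, raise_monomial, ← add_smul]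
  congr 1
  ring

theorem natCast_pow_sub_one_eq_one (p c : ℕ) [Fact p.Prime] [CharP k p] (hc : ¬ p ∣ c) :
    (c : k) ^ (p - 1) = 1 := by
  have h := ZMod.pow_card_sub_one_eq_one (p := p) (a := (c : ZMod p))
    (by rwa [Ne, ZMod.natCast_eq_zero_iff])
  simpa using congrArg (ZMod.castHom (dvd_refl p) k) h

theorem natCast_factorial_sub_one (A : Type*) [Ring A] (p : ℕ) [Fact p.Prime] [CharP A p] :
    ((p - 1).factorial : A) = -1 := by
  have h := congrArg (ZMod.castHom (dvd_refl p) A) (ZMod.wilsons_lemma p)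
  rwa [map_natCast, map_neg, map_one] at h

theorem not_dvd_card_filter {p c l : ℕ} (hl : c * p + l < n) (hn : n < (c + 1) * p)
    {u : Fin n → ℕ} (hu : Function.Injective u) :
    ¬ p ∣ (Finset.univ.filter fun i => l ≤ u i).card := by
  have hsmall : (Finset.univ.filter fun i => ¬ l ≤ u i).card ≤ l := by
    rw [← Finset.card_range l]
    refine Finset.card_le_card_of_injOn u (fun i hi => ?_) hu.injOn
    simpa using hi
  have hadd := Finset.card_filter_add_card_filter_not (s := (Finset.univ : Finset (Fin n)))
    (fun i => l ≤ u i)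
  rw [Finset.card_univ, Fintype.card_fin] at hadd
  rintro ⟨q, hq⟩
  rw [hq] at hadd
  have h1 : c < q := by
    by_contra! h
    nlinarith [Nat.mul_le_mul_left p h]
  nlinarith [Nat.mul_le_mul_left p (Nat.succ_le_of_lt h1)]

theorem IsAlternating.sum_cutoff_pow {p c l : ℕ} [Fact p.Prime] [CharP k p]
    (hl : c * p + l < n) (hn : n < (c + 1) * p) {g : MvPolynomial (Fin n) k}
    (hg : IsAlternating g) :
    ((∑ i, cutoff k l i : Module.End k (MvPolynomial (Fin n) k)) ^ (p - 1)) g = g := by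
  ext u
  rw [coeff_sum_cutoff_pow]
  by_cases hu : Function.Injective u
  · rw [natCast_pow_sub_one_eq_one p _ (not_dvd_card_filter hl hn hu), one_mul]
  · rw [hg.coeff_eq_zero hu, mul_zero]

theorem IsAlternating.exists_sum_raise_pow_eq {p c l : ℕ} [hp : Fact p.Prime] [CharP k p]
    [CharP (Module.End k (MvPolynomial (Fin n) k)) p]
    (hl : c * p + l < n) (hn : n < (c + 1) * p) {g : MvPolynomial (Fin n) k}
    (hg : IsAlternating g) {s : ℕ} (hs : s ≤ p)
    (h0 : ((∑ i, raise k l i : Module.End k (MvPolynomial (Fin n) k)) ^ s) g = 0) :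
    ∃ g', IsAlternating g' ∧
      ((∑ i, raise k l i : Module.End k (MvPolynomial (Fin n) k)) ^ (p - s)) g' = g := by
  set E : Module.End k (MvPolynomial (Fin n) k) := ∑ i, raise k l i with hE
  set F : Module.End k (MvPolynomial (Fin n) k) := ∑ i, lower k p l i with hF
  set N : Module.End k (MvPolynomial (Fin n) k) := ∑ i, cutoff k l i with hN
  have hEN : Commute E N := Commute.sum_left _ _ _ fun i _ => Commute.sum_right _ _ _ fun j _ =>
    commute_raise_cutoff l i j
  have hFN : Commute F N := Commute.sum_left _ _ _ fun i _ => Commute.sum_right _ _ _ fun j _ =>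
    commute_lower_cutoff p l i j
  have hid : ∑ i ∈ Finset.range p, E ^ (p - 1 - i) * F ^ (p - 1) * E ^ i = -N ^ (p - 1) := by
    rw [sum_pow_mul_mul_pow_eq_iterate_commutator,
      iterate_commutator_pow E F N (sum_raise_lower_commutator p l) hEN hFN,
      natCast_factorial_sub_one]
    exact neg_one_mul (N ^ (p - 1))
  refine ⟨-∑ i ∈ Finset.range s, (E ^ (s - 1 - i)) ((F ^ (p - 1)) ((E ^ i) g)), ?_, ?_⟩
  · refine (IsAlternating.sum _ _ fun i => ?_).neg
    exact ((hg.pow E (rename_sum_raise l) i).pow F (rename_sum_lower p l) _).pow E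
      (rename_sum_raise l) _
  · have happ := LinearMap.congr_fun hid g
    rw [LinearMap.neg_apply, hN, hg.sum_cutoff_pow hl hn, LinearMap.sum_apply] at happ
    rw [map_neg, map_sum, neg_eq_iff_eq_neg, ← happ]
    refine Finset.sum_subset_zero_on_sdiff (Finset.range_mono hs) (fun i hi => ?_) fun i hi => ?_
    · rw [Finset.mem_sdiff, Finset.mem_range, Finset.mem_range] at hi
      have hi0 : (E ^ i) g = 0 := by
        rw [← Nat.sub_add_cancel (not_lt.1 hi.2), pow_add, Module.End.mul_apply, h0, map_zero]
      rw [Module.End.mul_apply, hi0, map_zero]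
    · rw [Finset.mem_range] at hi
      rw [← Module.End.mul_apply, ← pow_add, Module.End.mul_apply, Module.End.mul_apply]
      congr 3
      omega

end

/-- For `cp ≤ n ≤ (c+1)p − 1`, `n ≥ 1` and `1 ≤ a ≤ n − cp`, the rank-one twisted
`p`-complex `(Sym_n, D_a)` with `D_a(f) = ∂(f) + a·e_1·f` is acyclic. -/
theorem stmt11 (p : ℕ) (hp : p.Prime) (k : Type*) [Field k] [CharP k p]
    (c n a : ℕ) (hcn : c * p ≤ n) (hnc : n ≤ (c + 1) * p - 1) (hn : 1 ≤ n)
    (ha1 : 1 ≤ a) (ha2 : a ≤ n - c * p)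
    (D : Derivation k (MvPolynomial (Fin n) k) (MvPolynomial (Fin n) k))
    (hD : ∀ i, D (X i) = X i ^ 2)
    (Da : MvPolynomial (Fin n) k → MvPolynomial (Fin n) k)
    (hDa : ∀ f, Da f = D f + (a : MvPolynomial (Fin n) k) * (esymm (Fin n) k 1 * f)) :
    ∀ s : ℕ, 1 ≤ s → s ≤ p - 1 →
      {f | f.IsSymmetric ∧ Da^[s] f = 0} = Da^[p - s] '' {f | f.IsSymmetric} := by
  have := Fact.mk hp
  have : CharP (Module.End k (MvPolynomial (Fin n) k)) p :=
    charP_of_injective_algebraMap (algebraMap k _).injective p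
  obtain ⟨l, hl⟩ : ∃ l, n = c * p + a + l := ⟨n - c * p - a, by omega⟩
  have hpos : 0 < (c + 1) * p := Nat.mul_pos c.succ_pos hp.pos
  set E : Module.End k (MvPolynomial (Fin n) k) := ∑ i, raise k l i with hE
  have hcast : (n : MvPolynomial (Fin n) k) = a + l := by
    have h := congrArg (Nat.cast : ℕ → MvPolynomial (Fin n) k) hl
    push_cast at h
    rwa [CharP.cast_eq_zero (MvPolynomial (Fin n) k) p, mul_zero, zero_add] at h
  have hEDa (f) : E (vdm n k * f) = vdm n k * Da f := by
    rw [hE, sum_raise_apply l D hD, hDa, D.leibniz, derivation_vdm D hD, smul_eq_mul, smul_eq_mul,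
      hcast]
    ring
  have hEpow (t : ℕ) (f) : (E ^ t) (vdm n k * f) = vdm n k * Da^[t] f := by
    induction t generalizing f with
    | zero => rfl
    | succ t ih => rw [pow_succ, Module.End.mul_apply, hEDa, ih, Function.iterate_succ_apply]
  have hsymm (t : ℕ) (f) (hf : f.IsSymmetric) : (Da^[t] f).IsSymmetric := by
    obtain ⟨f', hf', h⟩ :=
      ((isAlternating_vdm_mul hf).pow E (rename_sum_raise l) t).exists_eq_vdm_mul
    rw [hEpow] at h
    rwa [mul_left_cancel₀ vdm_ne_zero h]
  intro s hs1 hs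
  ext f
  constructor
  · rintro ⟨hf, h0⟩
    obtain ⟨g, hg, hgf⟩ := (isAlternating_vdm_mul hf).exists_sum_raise_pow_eq (p := p) (c := c)
      (l := l) (s := s) (by omega) (by omega) (by omega) (by rw [← hE, hEpow, h0, mul_zero])
    obtain ⟨f', hf', rfl⟩ := hg.exists_eq_vdm_mul
    rw [← hE, hEpow] at hgf
    exact ⟨f', hf', mul_left_cancel₀ vdm_ne_zero hgf⟩
  · rintro ⟨f, hf, rfl⟩
    refine ⟨hsymm _ f hf, mul_left_cancel₀ vdm_ne_zero ?_⟩
    rw [← Function.iterate_add_apply, ← hEpow, Nat.add_sub_cancel' (by omega), hE,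
      sum_raise_pow_char, mul_zero, LinearMap.zero_apply]
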